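/- For A = ℤ[C₄], the integral group algebra of the cyclic group of order 4, the first homology of the partial complex, H₁ = ker ∂₁ / im ∂₂, is isomorphic as an abelian group to (ℤ/2ℤ)⁴; that is, HS₁(ℤ[C₄]) ≅ (ℤ/2ℤ)⁴. -/

import Mathlib

open TensorProduct

set_option synthInstance.maxHeartbeats 1000000
set_option maxHeartbeats 1000000

/-- The algebra `A = ℤ[C4]`, the integral group algebra of the cyclic group
of order 4. -/
abbrev A : Type := MonoidAlgebra ℤ (Multiplicative (ZMod 4))

/-- Classes `q a b c` of `tᵃ ⊗ tᵇ ⊗ tᶜ` in a quotient by the relations coming from `∂₂` depend only on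
the total degree and on whether at least two of the exponents are odd, and they are killed by `2`. -/
theorem class_eq_of_relations {Q : Type*} [AddCommGroup Q] {q : ZMod 4 → ZMod 4 → ZMod 4 → Q}
    (hq : ∀ a b c d, q (a + b) c d + q d (c + a) b + q (b + c + a) 0 d + q d (b + c) a = 0)
    (hq₀ : ∀ a, q 0 a 0 = 0) :
    (∀ s, 2 • q 1 (s + 2) 1 = 0) ∧
    ∀ a b c, q a b c = (a.val * b.val + b.val * c.val + c.val * a.val) • q 1 (a + b + c + 2) 1 := by
  have r1 (c) : q c 0 0 = 0 := by simpa [hq₀] using hq 0 0 c 0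
  have r2 (a c) : q 0 c a = - q a c 0 := by
    have := hq a 0 c 0
    simp [hq₀, r1] at this
    exact eq_neg_of_add_eq_zero_right this
  have r3 (c d) : q c 0 d = - q d c 0 := by
    have := hq 0 0 c d
    simp [r2] at this
    exact eq_neg_of_add_eq_zero_left this
  have anti (a b c) : q a b c + q c b a = 0 := by
    have := hq 0 a b c
    simp only [r3, add_zero, zero_add] at this
    rw [← this]; abel
  have der (a b c d) : q d c (a + b) = q d (c + a) b + q d (c + b) a - q d (a + b + c) 0 := by
    have h := hq a b c d
    have h' := anti (a + b) c d
    rw [r3, show b + c + a = a + b + c by ring, show b + c = c + b by ring] at h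
    grind
  have two (n) : 2 • q 1 n 1 = 0 := by rw [two_nsmul]; exact anti 1 n 1
  have f (a b c) : q (a + b) c 0 = q b (c + a) 0 + q a (c + b) 0 := by
    have h := der a b c 0
    rw [r2 (a + b), r2 b, r2 a, hq₀, sub_zero] at h
    rw [← neg_inj, h]; abel
  have f2 (c) : q 2 c 0 = 2 • q 1 (c + 1) 0 := by rw [two_nsmul]; exact f 1 1 c
  have f3 (c) : q 3 c 0 = 3 • q 1 (c + 2) 0 := by
    have := f 1 2 c
    rw [f2, add_assoc] at this
    exact this.trans (succ_nsmul _ 2).symm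
  have g2 (d c) : q d c 2 = 2 • q d (c + 1) 1 - q d (c + 2) 0 := by
    rw [two_nsmul, show c + 2 = 1 + 1 + c by ring]; exact der 1 1 c d
  have g3 (d c) : q d c 3 = q d (c + 1) 2 + q d (c + 2) 1 - q d (c + 3) 0 := by
    rw [show c + 3 = 1 + 2 + c by ring]; exact der 1 2 c d
  have F0 : q 1 0 0 = 0 := r1 1
  have F1 : q 1 1 0 = q 1 0 1 := by
    have := two 0
    rw [r3] at this ⊢
    grind
  have F2 : q 1 2 0 = 0 := by
    have h2 := f 3 1 3
    change q 0 3 0 = q 1 2 0 + q 3 0 0 at h2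
    rw [hq₀, r1, add_zero] at h2
    exact h2.symm
  have F3 : q 1 3 0 = q 1 2 1 := by
    have h1 := g3 1 0
    have h2 := g2 1 1
    have h3 := r3 1 3
    have h4 := f3 1
    have h5 := two 2
    rw [show (1 : ZMod 4) + 2 = 3 by rfl] at h2 h4
    rw [show (0 : ZMod 4) + 1 = 1 by rfl, zero_add, zero_add, h2, h3, h4] at h1
    rw [show (1 : ZMod 4) + 1 = 2 by rfl] at h1
    linear_combination (norm := module) (-1 : ℤ) • h1 - (2 : ℤ) • h5
  have F (c) : q 1 c 0 = c.val • q 1 (c + 3) 1 := by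
    have h1 := two 1
    have h2 := two 2
    fin_cases c
    · exact F0.trans (zero_nsmul _).symm
    · exact F1.trans (one_nsmul _).symm
    · exact F2.trans h1.symm
    · refine F3.trans (Eq.symm (?_ : 3 • q 1 2 1 = _))
      rw [succ_nsmul, h2, zero_add]
  have hV (m n : ℕ) (s) (h : m % 2 = n % 2) : m • q 1 s 1 = n • q 1 s 1 := by
    rw [← Nat.div_add_mod m 2, ← Nat.div_add_mod n 2, h, add_nsmul, add_nsmul, mul_nsmul, mul_nsmul,
      two, nsmul_zero, nsmul_zero]
  have cases4 (x : ZMod 4) : x = 0 ∨ x = 1 ∨ x = 2 ∨ x = 3 := by revert x; decide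
  have v0 : (0 : ZMod 4).val = 0 := rfl
  have v1 : (1 : ZMod 4).val = 1 := rfl
  have v2 : (2 : ZMod 4).val = 2 := rfl
  have v3 : (3 : ZMod 4).val = 3 := rfl
  have F' (a c) : q a c 0 = (a.val * c.val) • q 1 (a + c + 2) 1 := by
    rcases cases4 a with rfl | rfl | rfl | rfl
    · simp [hq₀]
    · rw [F, v1, one_mul, show c + 3 = 1 + c + 2 by ring]
    · rw [f2, F, v2, mul_nsmul', smul_comm, two, smul_comm, two, nsmul_zero, nsmul_zero]
    · rw [f3, F, v3, ← mul_nsmul', show c + 2 + 3 = 3 + c + 2 by ring]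
      exact hV _ _ _ (by revert c; decide)
  have neg (m : ℕ) (s) : -(m • q 1 s 1) = m • q 1 s 1 := by
    rw [neg_eq_iff_add_eq_zero, ← two_nsmul, smul_comm, two, nsmul_zero]
  have G2 (c) : q 1 c 2 = (c + 2).val • q 1 (c + 1) 1 := by
    rw [g2, two, zero_sub, F, neg, add_assoc]; rfl
  have G3 (c) : q 1 c 3 = q 1 (c + 2) 1 := by
    rw [g3, G2, F, sub_eq_add_neg, neg, show c + 3 + 3 = c + 2 by grind,
      show c + 1 + 1 = c + 2 by ring, show c + 1 + 2 = c + 3 by ring, add_right_comm,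
      ← two_nsmul, smul_comm, two, nsmul_zero, zero_add]
  have V (a c) : q a c 1 = (a.val * c.val + c.val + a.val) • q 1 (a + c + 3) 1 := by
    rcases cases4 a with rfl | rfl | rfl | rfl
    · rw [r2, F, neg, v0, zero_add]
      exact hV _ _ _ (by omega)
    · rw [← one_nsmul (q 1 c 1), show 1 + c + 3 = c by grind]
      exact hV _ _ _ (by rw [v1]; omega)
    · rw [eq_neg_of_add_eq_zero_left (anti 2 c 1), G2, neg, show 2 + c + 3 = c + 1 by grind]
      exact hV _ _ _ (by revert c; decide)
    · rw [eq_neg_of_add_eq_zero_left (anti 3 c 1), G3, ← one_nsmul (q 1 _ 1), neg,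
        show 3 + c + 3 = c + 2 by grind]
      exact hV _ _ _ (by revert c; decide)
  have W (a c) : q a c 2 = (a.val * c.val) • q 1 (a + c) 1 := by
    rw [g2, V, F', sub_eq_add_neg, neg, smul_comm, two, nsmul_zero, zero_add,
      show a + (c + 2) + 2 = a + c by grind]
    exact hV _ _ _ (by revert a c; decide)
  refine ⟨fun s => two _, fun a b c => ?_⟩
  rcases cases4 c with rfl | rfl | rfl | rfl
  · simp [F']
  · rw [V, show a + b + 1 + 2 = a + b + 3 by ring, v1, mul_one, one_mul]
  · rw [W, show a + b + 2 + 2 = a + b by grind]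
    exact hV _ _ _ (by revert a b; decide)
  · rw [g3, W, V a (b + 2), F', sub_eq_add_neg, neg, show a + (b + 3) + 2 = a + b + 1 by grind,
      show a + (b + 2) + 3 = a + b + 1 by grind, show a + b + 3 + 2 = a + b + 1 by grind,
      ← add_assoc a b 1, ← add_nsmul, ← add_nsmul]
    exact hV _ _ _ (by revert a b; decide)

/-- The group-like element of `A` attached to `x`. -/
noncomputable def g (x : ZMod 4) : A := MonoidAlgebra.of ℤ _ (Multiplicative.ofAdd x)

theorem g_add (x y : ZMod 4) : g (x + y) = g x * g y := by
  simp [g, ofAdd_add]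

theorem g_zero : g 0 = 1 := rfl

/-- The basis of `A` given by the group elements. -/
noncomputable def basisA : Module.Basis (ZMod 4) ℤ A :=
  (MonoidAlgebra.basis (Multiplicative (ZMod 4)) ℤ).reindex Multiplicative.toAdd

theorem basisA_apply (x : ZMod 4) : basisA x = g x := by
  simp [basisA, g]

/-- The basis of `A ⊗ A ⊗ A` given by triples of group elements. -/
noncomputable def basis3 : Module.Basis (ZMod 4 × ZMod 4 × ZMod 4) ℤ (A ⊗[ℤ] (A ⊗[ℤ] A)) :=
  basisA.tensorProduct (basisA.tensorProduct basisA)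

theorem basis3_apply (x y z : ZMod 4) : basis3 (x, y, z) = g x ⊗ₜ (g y ⊗ₜ g z) := by
  simp only [← basisA_apply]
  refine (Module.Basis.tensorProduct_apply _ _ _ _).trans ?_
  exact congrArg _ (Module.Basis.tensorProduct_apply _ _ _ _)

/-- The second elementary symmetric function of the exponents, placed in their total degree. -/
def wt (x : ZMod 4 × ZMod 4 × ZMod 4) : ZMod 4 → ℕ :=
  Pi.single (x.1 + x.2.1 + x.2.2) (x.1.val * x.2.1.val + x.2.1.val * x.2.2.val + x.2.2.val * x.1.val)

/-- The linear extension of `wt`. -/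
noncomputable def intSymbol : A ⊗[ℤ] (A ⊗[ℤ] A) →ₗ[ℤ] (ZMod 4 → ℤ) :=
  basis3.constr ℤ fun x s => (wt x s : ℤ)

/-- The reduction of `intSymbol` modulo `2`; it induces the isomorphism from the first homology. -/
noncomputable def symbol : A ⊗[ℤ] (A ⊗[ℤ] A) →ₗ[ℤ] (ZMod 4 → ZMod 2) :=
  (Int.castAddHom (ZMod 2)).toIntLinearMap.compLeft (ZMod 4) ∘ₗ intSymbol

theorem intSymbol_tmul (x y z s : ZMod 4) :
    intSymbol (g x ⊗ₜ (g y ⊗ₜ g z)) s = (wt (x, y, z) s : ℤ) := by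
  rw [intSymbol, ← basis3_apply, Module.Basis.constr_basis]

theorem symbol_apply (x) (s : ZMod 4) : symbol x s = ((intSymbol x s : ℤ) : ZMod 2) := rfl

theorem symbol_tmul (x y z s : ZMod 4) :
    symbol (g x ⊗ₜ (g y ⊗ₜ g z)) s = (wt (x, y, z) s : ZMod 2) := by
  rw [symbol_apply, intSymbol_tmul, Int.cast_natCast]

theorem symbol_surjective : Function.Surjective symbol := by
  intro v
  refine ⟨∑ s : ZMod 4, (v s).val • (g 1 ⊗ₜ (g (s + 2) ⊗ₜ g 1)), ?_⟩
  funext t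
  rw [map_sum, Finset.sum_apply]
  simp only [map_nsmul, Pi.smul_apply, symbol_tmul]
  revert v t
  decide

theorem symbol_comp_eq_zero
    {d₂ : ((A ⊗[ℤ] (A ⊗[ℤ] (A ⊗[ℤ] A))) × A) →ₗ[ℤ] A ⊗[ℤ] (A ⊗[ℤ] A)}
    (h₂ : ∀ a b c d : A, d₂ (a ⊗ₜ[ℤ] (b ⊗ₜ[ℤ] (c ⊗ₜ[ℤ] d)), 0) =
      (a * b) ⊗ₜ[ℤ] (c ⊗ₜ[ℤ] d) + d ⊗ₜ[ℤ] ((c * a) ⊗ₜ[ℤ] b) +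
        (b * c * a) ⊗ₜ[ℤ] ((1 : A) ⊗ₜ[ℤ] d) + d ⊗ₜ[ℤ] ((b * c) ⊗ₜ[ℤ] a))
    (h₃ : ∀ a : A, d₂ (0, a) = (1 : A) ⊗ₜ[ℤ] (a ⊗ₜ[ℤ] (1 : A))) :
    symbol ∘ₗ d₂ = 0 := by
  refine LinearMap.prod_ext ?_ ?_
  · refine (basisA.tensorProduct basis3).ext ?_
    rintro ⟨a, b, c, d⟩
    have h : (basisA.tensorProduct basis3) (a, b, c, d) =
        g a ⊗ₜ[ℤ] (g b ⊗ₜ[ℤ] (g c ⊗ₜ[ℤ] g d)) := by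
      rw [← basis3_apply, ← basisA_apply]
      exact Module.Basis.tensorProduct_apply _ _ _ _
    rw [h]
    funext t
    change symbol (d₂ (g a ⊗ₜ[ℤ] (g b ⊗ₜ[ℤ] (g c ⊗ₜ[ℤ] g d)), 0)) t = 0
    rw [h₂]
    simp only [map_add, Pi.add_apply, ← g_add, ← g_zero, symbol_tmul]
    clear h h₂ h₃
    revert a b c d t
    decide
  · refine basisA.ext fun a => ?_
    funext t
    simp only [basisA_apply, LinearMap.comp_apply, LinearMap.inr_apply, h₃, ← g_zero, symbol_tmul]
    change _ = (0 : ZMod 2)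
    revert a t
    decide

theorem ker_symbol_le_range
    {d₂ : ((A ⊗[ℤ] (A ⊗[ℤ] (A ⊗[ℤ] A))) × A) →ₗ[ℤ] A ⊗[ℤ] (A ⊗[ℤ] A)}
    (h₂ : ∀ a b c d : A, d₂ (a ⊗ₜ[ℤ] (b ⊗ₜ[ℤ] (c ⊗ₜ[ℤ] d)), 0) =
      (a * b) ⊗ₜ[ℤ] (c ⊗ₜ[ℤ] d) + d ⊗ₜ[ℤ] ((c * a) ⊗ₜ[ℤ] b) +
        (b * c * a) ⊗ₜ[ℤ] ((1 : A) ⊗ₜ[ℤ] d) + d ⊗ₜ[ℤ] ((b * c) ⊗ₜ[ℤ] a))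
    (h₃ : ∀ a : A, d₂ (0, a) = (1 : A) ⊗ₜ[ℤ] (a ⊗ₜ[ℤ] (1 : A))) :
    LinearMap.ker symbol ≤ LinearMap.range d₂ := by
  obtain ⟨two, hq⟩ := class_eq_of_relations (Q := _ ⧸ LinearMap.range d₂)
    (q := fun x y z => (LinearMap.range d₂).mkQ (g x ⊗ₜ (g y ⊗ₜ g z)))
    (fun a b c d => by
      simp only [← map_add, g_add, g_zero, ← h₂]
      exact (Submodule.Quotient.mk_eq_zero _).2 ⟨_, rfl⟩)
    (fun a => by
      simp only [g_zero, ← h₃]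
      exact (Submodule.Quotient.mk_eq_zero _).2 ⟨_, rfl⟩)
  have key : (LinearMap.range d₂).mkQ = (Fintype.linearCombination ℤ fun s =>
      (LinearMap.range d₂).mkQ (g 1 ⊗ₜ (g (s + 2) ⊗ₜ g 1))) ∘ₗ intSymbol := by
    refine basis3.ext ?_
    rintro ⟨a, b, c⟩
    rw [basis3_apply, hq, LinearMap.comp_apply, Fintype.linearCombination_apply,
      Finset.sum_eq_single (a + b + c)]
    · simp only [intSymbol_tmul, wt, Pi.single_eq_same, natCast_zsmul]
    · intro s _ hs
      simp [intSymbol_tmul, wt, hs]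
    · simp
  intro x hx
  rw [← Submodule.Quotient.mk_eq_zero, ← Submodule.mkQ_apply, key, LinearMap.comp_apply,
    Fintype.linearCombination_apply]
  refine Finset.sum_eq_zero fun s _ => ?_
  obtain ⟨k, hk⟩ := (ZMod.intCast_zmod_eq_zero_iff_dvd _ 2).1
    (congrFun hx s : ((intSymbol x s : ℤ) : ZMod 2) = 0)
  rw [hk, mul_comm, mul_smul, Nat.cast_smul_eq_nsmul, two, smul_zero]

/-- HS₁(ℤ[C₄]) ≅ (ℤ/2ℤ)⁴: the first homology `ker ∂₁ / im ∂₂` of the partial complex is isomorphic as an abelian group to `(ℤ/2ℤ)⁴`. -/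
theorem HS1_int_C4
    (d₁ : A ⊗[ℤ] (A ⊗[ℤ] A) →ₗ[ℤ] A)
    (d₂ : ((A ⊗[ℤ] (A ⊗[ℤ] (A ⊗[ℤ] A))) × A) →ₗ[ℤ] A ⊗[ℤ] (A ⊗[ℤ] A))
    (h₁ : ∀ a b c : A, d₁ (a ⊗ₜ[ℤ] (b ⊗ₜ[ℤ] c)) = a * b * c - c * b * a)
    (h₂ : ∀ a b c d : A, d₂ (a ⊗ₜ[ℤ] (b ⊗ₜ[ℤ] (c ⊗ₜ[ℤ] d)), 0) =
      (a * b) ⊗ₜ[ℤ] (c ⊗ₜ[ℤ] d) + d ⊗ₜ[ℤ] ((c * a) ⊗ₜ[ℤ] b) +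
        (b * c * a) ⊗ₜ[ℤ] ((1 : A) ⊗ₜ[ℤ] d) + d ⊗ₜ[ℤ] ((b * c) ⊗ₜ[ℤ] a))
    (h₃ : ∀ a : A, d₂ (0, a) = (1 : A) ⊗ₜ[ℤ] (a ⊗ₜ[ℤ] (1 : A))) :
    Nonempty
      ((↥(LinearMap.ker d₁) ⧸
          Submodule.comap (LinearMap.ker d₁).subtype (LinearMap.range d₂)) ≃+
        (Fin 4 → ZMod 2)) := by
  have hd₁ : LinearMap.ker d₁ = ⊤ := by
    refine LinearMap.ker_eq_top.2 (basis3.ext ?_)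
    rintro ⟨a, b, c⟩
    rw [basis3_apply, h₁, LinearMap.zero_apply]
    ring
  have hker : LinearMap.ker symbol = LinearMap.range d₂ :=
    le_antisymm (ker_symbol_le_range h₂ h₃)
      (LinearMap.range_le_ker_iff.2 (symbol_comp_eq_zero h₂ h₃))
  have hsurj : Function.Surjective (symbol ∘ₗ (LinearMap.ker d₁).subtype) := by
    intro v
    obtain ⟨x, hx⟩ := symbol_surjective v
    exact ⟨⟨x, hd₁ ▸ Submodule.mem_top⟩, hx⟩
  refine ⟨((Submodule.quotEquivOfEq _ _ ?_).trans
    ((LinearMap.quotKerEquivOfSurjective _ hsurj).trans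
      (LinearEquiv.funCongrLeft ℤ (ZMod 2) (ZMod.finEquiv 4).toEquiv))).toAddEquiv⟩
  rw [LinearMap.ker_comp, hker]
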